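/- Let n ≥ 3 and let P be the normalized (n−1)-dimensional Hausdorff probability measure on S^{n−1} ⊂ ℝⁿ. There exist s ∈ (0,1) and a continuous odd function F : S^{n−1} → ℝ (odd meaning F(−v) = −F(v) for all v), not identically zero, such that for every unit vector u the integral of F over the cap C_s(u) = { v ∈ S^{n−1} : u · v ≥ s } with respect to P vanishes: ∫_{C_s(u)} F dP = 0. -/

import Mathlib

open MeasureTheory Metric
open scoped RealInnerProductSpace

/-- The normalized `(n-1)`-dimensional Hausdorff probability measure on the unit sphere
`S^{n-1} ⊂ ℝⁿ`. -/
noncomputable def sphereMeasure (n : ℕ) :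
    Measure (sphere (0 : EuclideanSpace ℝ (Fin n)) 1) :=
  (μH[(n : ℝ) - 1] (Set.univ : Set (sphere (0 : EuclideanSpace ℝ (Fin n)) 1)))⁻¹ •
    μH[(n : ℝ) - 1]

/-- The spherical cap `C_s(w) = {v ∈ S^{n-1} : w ⬝ v ≥ s}`. -/
def cap (n : ℕ) (s : ℝ) (w : sphere (0 : EuclideanSpace ℝ (Fin n)) 1) :
    Set (sphere (0 : EuclideanSpace ℝ (Fin n)) 1) :=
  {v | s ≤ ⟪(w : EuclideanSpace ℝ (Fin n)), (v : EuclideanSpace ℝ (Fin n))⟫}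

section CapWeight

/-- Continuous approximations of `x ↦ 2 x 1_{x ≥ s}`, exact on `[s, ∞)`. -/
noncomputable def capWeight (s : ℝ) (k : ℕ) (x : ℝ) : ℝ :=
  2 * max x s * Real.exp (k * (min x s - s))

theorem continuous_capWeight (s : ℝ) (k : ℕ) : Continuous (capWeight s k) := by
  unfold capWeight
  fun_prop

theorem hasDerivAt_integral_capWeight (s : ℝ) (k : ℕ) (t : ℝ) :
    HasDerivAt (fun t => ∫ x in s..t, capWeight s k x) (capWeight s k t) t :=
  intervalIntegral.integral_hasDerivAt_right ((continuous_capWeight s k).intervalIntegrable _ _)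
    ((continuous_capWeight s k).stronglyMeasurableAtFilter _ _)
    (continuous_capWeight s k).continuousAt

theorem abs_capWeight_le {s : ℝ} (hs0 : 0 ≤ s) (hs1 : s ≤ 1) (k : ℕ) {x : ℝ} (hx : |x| ≤ 1) :
    |capWeight s k x| ≤ 2 := by
  have hm0 : 0 ≤ max x s := le_max_of_le_right hs0
  have hm1 : max x s ≤ 1 := max_le (abs_le.1 hx).2 hs1
  have he : Real.exp (k * (min x s - s)) ≤ 1 := Real.exp_le_one_iff.2
    (mul_nonpos_of_nonneg_of_nonpos k.cast_nonneg (sub_nonpos.2 (min_le_right _ _)))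
  rw [capWeight, abs_of_nonneg (by positivity)]
  nlinarith [Real.exp_pos (k * (min x s - s))]

theorem abs_le_one_of_mem_uIoc {s t x : ℝ} (hs0 : 0 ≤ s) (hs1 : s ≤ 1) (ht : |t| ≤ 1)
    (hx : x ∈ Set.uIoc s t) : |x| ≤ 1 := by
  have hx' := Set.uIoc_subset_uIcc hx
  have hsub : Set.uIcc s t ⊆ Set.Icc (-1) 1 :=
    Set.uIcc_subset_Icc ⟨by linarith, hs1⟩ (abs_le.1 ht)
  exact abs_le.2 (hsub hx')

theorem abs_integral_capWeight_le {s : ℝ} (hs0 : 0 ≤ s) (hs1 : s ≤ 1) (k : ℕ) {t : ℝ}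
    (ht : |t| ≤ 1) : |∫ x in s..t, capWeight s k x| ≤ 4 := by
  have hb := intervalIntegral.norm_integral_le_of_norm_le_const (f := capWeight s k) (C := 2)
    fun x hx => abs_capWeight_le hs0 hs1 k (abs_le_one_of_mem_uIoc hs0 hs1 ht hx)
  have hts : |t - s| ≤ 2 := abs_le.2 ⟨by linarith [(abs_le.1 ht).1], by linarith [(abs_le.1 ht).2]⟩
  exact hb.trans (by linarith)

theorem tendsto_capWeight (s x : ℝ) :
    Filter.Tendsto (fun k => capWeight s k x) Filter.atTop
      (nhds (2 * x * (Set.Ici s).indicator 1 x)) := by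
  rcases le_or_gt s x with hx | hx
  · simp [capWeight, hx]
  · have hneg : min x s - s < 0 := by rw [min_eq_left hx.le]; linarith
    have he : Filter.Tendsto (fun k : ℕ => Real.exp (k * (min x s - s))) Filter.atTop (nhds 0) :=
      Real.tendsto_exp_atBot.comp
        (tendsto_natCast_atTop_atTop.atTop_mul_const_of_neg hneg)
    simpa [capWeight, hx] using he.const_mul (2 * max x s)

theorem integral_two_mul_indicator (s t : ℝ) :
    ∫ x in s..t, 2 * x * (Set.Ici s).indicator 1 x = (t ^ 2 - s ^ 2) * (Set.Ici s).indicator 1 t := by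
  rcases le_or_gt s t with hst | hst
  · have hcongr : ∫ x in s..t, 2 * x * (Set.Ici s).indicator 1 x = ∫ x in s..t, 2 * x := by
      refine intervalIntegral.integral_congr fun x hx => ?_
      rw [Set.uIcc_of_le hst] at hx
      simp [hx.1]
    rw [hcongr, intervalIntegral.integral_const_mul, integral_id]
    simp [hst]
    ring
  · rw [intervalIntegral.integral_symm, intervalIntegral.integral_of_le hst.le,
      integral_Ioc_eq_integral_Ioo, setIntegral_congr_fun (g := fun _ => 0) measurableSet_Ioo]
    · simp [hst]
    · intro x hx
      simp [hx.2]

theorem tendsto_integral_capWeight {s t : ℝ} (hs0 : 0 ≤ s) (hs1 : s ≤ 1) (ht : |t| ≤ 1) :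
    Filter.Tendsto (fun k => ∫ x in s..t, capWeight s k x) Filter.atTop
      (nhds ((t ^ 2 - s ^ 2) * (Set.Ici s).indicator 1 t)) := by
  rw [← integral_two_mul_indicator]
  refine intervalIntegral.tendsto_integral_filter_of_dominated_convergence (fun _ => 2)
    (Filter.Eventually.of_forall fun k => (continuous_capWeight s k).aestronglyMeasurable)
    (Filter.Eventually.of_forall fun k => Filter.Eventually.of_forall fun x hx =>
      abs_capWeight_le hs0 hs1 k (abs_le_one_of_mem_uIoc hs0 hs1 ht hx))
    intervalIntegrable_const
    (Filter.Eventually.of_forall fun x _ => tendsto_capWeight s x)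

end CapWeight

theorem inner_reflection_comm {E : Type*} [NormedAddCommGroup E] [InnerProductSpace ℝ E]
    (K : Submodule ℝ E) [K.HasOrthogonalProjection] (x v : E) :
    ⟪x, K.reflection v⟫ = ⟪K.reflection x, v⟫ := by
  rw [LinearIsometryEquiv.inner_map_eq_flip, Submodule.reflection_symm]

section RotationInvariant

variable {E : Type*} [NormedAddCommGroup E] [InnerProductSpace ℝ E]
  [MeasurableSpace E] [BorelSpace E]

/-- A measure concentrated on the unit sphere and invariant under all linear isometries. -/
structure IsInvariantOnSphere (ν : Measure E) : Prop where
  preserving : ∀ L : E ≃ₗᵢ[ℝ] E, MeasurePreserving L ν ν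
  norm_eq_one : ∀ᵐ v ∂ν, ‖v‖ = 1

/-- A measurable weight which is bounded on `[-1, 1]`. -/
def IsZonalWeight (G : ℝ → ℝ) : Prop :=
  Measurable G ∧ ∃ C, ∀ t, |t| ≤ 1 → |G t| ≤ C


namespace IsZonalWeight

theorem of_continuous_mul {f G : ℝ → ℝ} (hf : Continuous f) (hG : IsZonalWeight G) :
    IsZonalWeight fun t => f t * G t := by
  obtain ⟨hm, C, hC⟩ := hG
  obtain ⟨D, hD⟩ := (isCompact_Icc (a := (-1 : ℝ)) (b := 1)).exists_bound_of_continuousOn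
    hf.continuousOn
  refine ⟨hf.measurable.mul hm, D * C, fun t ht => ?_⟩
  rw [abs_mul]
  exact mul_le_mul (hD t (abs_le.1 ht)) (hC t ht) (abs_nonneg _)
    ((abs_nonneg _).trans (hD t (abs_le.1 ht)))

theorem indicator_Ici (s : ℝ) : IsZonalWeight ((Set.Ici s).indicator 1) := by
  refine ⟨measurable_one.indicator measurableSet_Ici, 1, fun t _ => ?_⟩
  by_cases h : t ∈ Set.Ici s <;> simp [h]

end IsZonalWeight

namespace IsInvariantOnSphere

variable {ν : Measure E}

theorem integral_comp (h : IsInvariantOnSphere ν) (L : E ≃ₗᵢ[ℝ] E) (f : E → ℝ) :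
    ∫ v, f (L v) ∂ν = ∫ v, f v ∂ν :=
  (h.preserving L).integral_comp L.toHomeomorph.measurableEmbedding f

theorem integral_inner_sq_eq_of_norm_eq (h : IsInvariantOnSphere ν) (G : ℝ → ℝ) {u x y : E}
    (hx : ⟪u, x⟫ = 0) (hy : ⟪u, y⟫ = 0) (hxy : ‖x‖ = ‖y‖) :
    ∫ v, ⟪x, v⟫ ^ 2 * G ⟪u, v⟫ ∂ν = ∫ v, ⟪y, v⟫ ^ 2 * G ⟪u, v⟫ ∂ν := by
  rw [← h.integral_comp (ℝ ∙ (x - y))ᗮ.reflection]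
  have hu : (ℝ ∙ (x - y))ᗮ.reflection u = u := by
    apply Submodule.reflection_mem_subspace_eq_self
    rw [Submodule.mem_orthogonal_singleton_iff_inner_left, inner_sub_right, hx, hy, sub_zero]
  simp only [inner_reflection_comm, hu, Submodule.reflection_sub hxy]

variable [FiniteDimensional ℝ E]

theorem integrable [IsFiniteMeasure ν] (h : IsInvariantOnSphere ν) {p : E → ℝ} (hp : Continuous p)
    {G : ℝ → ℝ} (hG : IsZonalWeight G) {u : E} (hu : ‖u‖ = 1) :
    Integrable (fun v => p v * G ⟪u, v⟫) ν := by
  obtain ⟨hm, C, hC⟩ := hG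
  obtain ⟨D, hD⟩ := (isCompact_sphere (0 : E) 1).exists_bound_of_continuousOn hp.continuousOn
  refine Integrable.of_bound (hp.measurable.mul
    (hm.comp (by fun_prop))).aestronglyMeasurable (D * C) ?_
  filter_upwards [h.norm_eq_one] with v hv
  have hvs : v ∈ sphere (0 : E) 1 := by simpa using hv
  rw [norm_mul]
  refine mul_le_mul (hD v hvs) (hC _ ?_) (abs_nonneg _) ((norm_nonneg _).trans (hD v hvs))
  simpa [hu, hv] using abs_real_inner_le_norm u v

theorem integrable_of_continuous [IsFiniteMeasure ν] (h : IsInvariantOnSphere ν) {p : E → ℝ}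
    (hp : Continuous p) : Integrable p ν := by
  obtain ⟨D, hD⟩ := (isCompact_sphere (0 : E) 1).exists_bound_of_continuousOn hp.continuousOn
  refine Integrable.of_bound hp.aestronglyMeasurable D ?_
  filter_upwards [h.norm_eq_one] with v hv
  exact hD v (by simpa using hv)

/-- Second moments orthogonal to the axis of a zonal weight are isotropic. -/
theorem integral_inner_mul_inner [IsFiniteMeasure ν] (h : IsInvariantOnSphere ν) {G : ℝ → ℝ}
    (hG : IsZonalWeight G) {u e x y : E} (hu : ‖u‖ = 1) (he : ‖e‖ = 1) (hue : ⟪u, e⟫ = 0)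
    (hx : ⟪u, x⟫ = 0) (hy : ⟪u, y⟫ = 0) :
    ∫ v, ⟪x, v⟫ * ⟪y, v⟫ * G ⟪u, v⟫ ∂ν = ⟪x, y⟫ * ∫ v, ⟪e, v⟫ ^ 2 * G ⟪u, v⟫ ∂ν := by
  have hsq : ∀ z : E, ⟪u, z⟫ = 0 →
      ∫ v, ⟪z, v⟫ ^ 2 * G ⟪u, v⟫ ∂ν = ‖z‖ ^ 2 * ∫ v, ⟪e, v⟫ ^ 2 * G ⟪u, v⟫ ∂ν := by
    intro z hz
    rw [h.integral_inner_sq_eq_of_norm_eq G (y := ‖z‖ • e) hz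
      (by rw [inner_smul_right, hue, mul_zero]) (by simp [norm_smul, he]), ← integral_const_mul]
    simp only [real_inner_smul_left, mul_pow, mul_assoc]
  have hpol : ∀ v : E, ⟪x, v⟫ * ⟪y, v⟫ * G ⟪u, v⟫ =
      1 / 4 * (⟪x + y, v⟫ ^ 2 * G ⟪u, v⟫ - ⟪x - y, v⟫ ^ 2 * G ⟪u, v⟫) := by
    intro v
    rw [inner_add_left, inner_sub_left]
    ring
  simp_rw [hpol]
  rw [integral_const_mul, integral_sub (h.integrable (by fun_prop) hG hu)
    (h.integrable (by fun_prop) hG hu), hsq (x + y) (by rw [inner_add_right, hx, hy, add_zero]),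
    hsq (x - y) (by rw [inner_sub_right, hx, hy, sub_zero]), norm_add_sq_real, norm_sub_sq_real]
  ring

/-- Third moments of a zonal weight in three pairwise orthogonal directions. -/
theorem integral_inner_mul_inner_mul_inner [IsFiniteMeasure ν] (h : IsInvariantOnSphere ν)
    {G : ℝ → ℝ} (hG : IsZonalWeight G) {u e a b c : E} (hu : ‖u‖ = 1) (he : ‖e‖ = 1)
    (hue : ⟪u, e⟫ = 0) (hab : ⟪a, b⟫ = 0) (hac : ⟪a, c⟫ = 0) (hbc : ⟪b, c⟫ = 0) :
    ∫ v, ⟪a, v⟫ * ⟪b, v⟫ * ⟪c, v⟫ * G ⟪u, v⟫ ∂ν =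
      ⟪u, a⟫ * ⟪u, b⟫ * ⟪u, c⟫ * (∫ v, ⟪u, v⟫ ^ 3 * G ⟪u, v⟫ ∂ν -
        3 * ∫ v, ⟪e, v⟫ ^ 2 * (⟪u, v⟫ * G ⟪u, v⟫) ∂ν) := by
  have huu : ⟪u, u⟫ = 1 := by rw [real_inner_self_eq_norm_sq, hu, one_pow]
  have hG' : IsZonalWeight fun t => t * G t := .of_continuous_mul continuous_id hG
  have hperp : ∀ x : E, ⟪u, x - ⟪u, x⟫ • u⟫ = 0 := fun x => by
    rw [inner_sub_right, inner_smul_right, huu, mul_one, sub_self]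
  have hmix : ∀ x y : E, ⟪x, y⟫ = 0 →
      ∫ v, ⟪x - ⟪u, x⟫ • u, v⟫ * ⟪y - ⟪u, y⟫ • u, v⟫ * (⟪u, v⟫ * G ⟪u, v⟫) ∂ν =
        -(⟪u, x⟫ * ⟪u, y⟫) * ∫ v, ⟪e, v⟫ ^ 2 * (⟪u, v⟫ * G ⟪u, v⟫) ∂ν := by
    intro x y hxy
    rw [h.integral_inner_mul_inner hG' hu he hue (hperp x) (hperp y)]
    congr 1
    simp only [inner_sub_left, inner_sub_right, real_inner_smul_left, real_inner_smul_right,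
      hxy, huu, real_inner_comm u x]
    ring
  have hsum : ∫ v, ⟪a, v⟫ * ⟪b, v⟫ * ⟪c, v⟫ * G ⟪u, v⟫ ∂ν =
      1 / 2 * ∫ v, (⟪a, v⟫ * ⟪b, v⟫ * ⟪c, v⟫ * G ⟪u, v⟫ +
        ⟪a, (ℝ ∙ u).reflection v⟫ * ⟪b, (ℝ ∙ u).reflection v⟫ *
          ⟪c, (ℝ ∙ u).reflection v⟫ * G ⟪u, (ℝ ∙ u).reflection v⟫) ∂ν := by
    have hint := h.integrable (p := fun v => ⟪a, v⟫ * ⟪b, v⟫ * ⟪c, v⟫) (by fun_prop) hG hu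
    have hint' := (h.preserving (ℝ ∙ u).reflection).integrable_comp_of_integrable hint
    simp only [Function.comp_def] at hint'
    rw [integral_add hint hint',
      h.integral_comp _ fun v => ⟪a, v⟫ * ⟪b, v⟫ * ⟪c, v⟫ * G ⟪u, v⟫]
    ring
  have hexp : ∀ v : E, ⟪a, v⟫ * ⟪b, v⟫ * ⟪c, v⟫ * G ⟪u, v⟫ +
        ⟪a, (ℝ ∙ u).reflection v⟫ * ⟪b, (ℝ ∙ u).reflection v⟫ *
          ⟪c, (ℝ ∙ u).reflection v⟫ * G ⟪u, (ℝ ∙ u).reflection v⟫ =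
      2 * (⟪u, a⟫ * ⟪u, b⟫ * ⟪u, c⟫) * (⟪u, v⟫ ^ 3 * G ⟪u, v⟫) +
      2 * ⟪u, a⟫ * (⟪b - ⟪u, b⟫ • u, v⟫ * ⟪c - ⟪u, c⟫ • u, v⟫ * (⟪u, v⟫ * G ⟪u, v⟫)) +
      2 * ⟪u, b⟫ * (⟪a - ⟪u, a⟫ • u, v⟫ * ⟪c - ⟪u, c⟫ • u, v⟫ * (⟪u, v⟫ * G ⟪u, v⟫)) +
      2 * ⟪u, c⟫ * (⟪a - ⟪u, a⟫ • u, v⟫ * ⟪b - ⟪u, b⟫ • u, v⟫ * (⟪u, v⟫ * G ⟪u, v⟫)) := by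
    intro v
    have hr : ∀ x : E, ⟪x, (ℝ ∙ u).reflection v⟫ = 2 * ⟪u, v⟫ * ⟪u, x⟫ - ⟪x, v⟫ := fun x => by
      rw [Submodule.reflection_singleton_apply, inner_sub_right, two_smul, inner_add_right,
        inner_smul_right, hu, real_inner_comm x u]
      simp
      ring
    have hru : ⟪u, (ℝ ∙ u).reflection v⟫ = ⟪u, v⟫ := by rw [hr, huu]; ring
    rw [hru, hr, hr, hr]
    simp only [inner_sub_left, real_inner_smul_left]
    ring
  simp_rw [hsum, hexp]
  have hi3 := h.integrable (p := fun v => ⟪u, v⟫ ^ 3) (by fun_prop) hG hu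
  have hi : ∀ x y : E, Integrable (fun v => ⟪x, v⟫ * ⟪y, v⟫ * (⟪u, v⟫ * G ⟪u, v⟫)) ν :=
    fun x y => h.integrable (p := fun v => ⟪x, v⟫ * ⟪y, v⟫) (by fun_prop) hG' hu
  rw [integral_add, integral_add, integral_add]
  · simp only [integral_const_mul]
    rw [hmix _ _ hab, hmix _ _ hac, hmix _ _ hbc]
    ring
  all_goals first
    | exact (hi _ _).const_mul _
    | exact hi3.const_mul _
    | exact (hi3.const_mul _).add ((hi _ _).const_mul _)
    | exact ((hi3.const_mul _).add ((hi _ _).const_mul _)).add ((hi _ _).const_mul _)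

/-- The trace of the second moments of a zonal weight. -/
theorem integral_inner_sq_add [IsFiniteMeasure ν] (h : IsInvariantOnSphere ν) {G : ℝ → ℝ}
    (hG : IsZonalWeight G) {u e : E} (hu : ‖u‖ = 1) (he : ‖e‖ = 1) (hue : ⟪u, e⟫ = 0) :
    ∫ v, ⟪u, v⟫ ^ 2 * G ⟪u, v⟫ ∂ν +
        (Module.finrank ℝ E - 1) * ∫ v, ⟪e, v⟫ ^ 2 * G ⟪u, v⟫ ∂ν = ∫ v, G ⟪u, v⟫ ∂ν := by
  have hu0 : u ≠ 0 := norm_ne_zero_iff.1 (by simp [hu])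
  have : Nontrivial E := ⟨u, 0, hu0⟩
  have : NeZero (Module.finrank ℝ E) := ⟨Module.finrank_pos.ne'⟩
  obtain ⟨b, hb⟩ := Orthonormal.exists_orthonormalBasis_extension_of_card_eq (𝕜 := ℝ)
    (ι := Fin (Module.finrank ℝ E)) (v := fun _ => u) (s := {0}) (by simp)
    ⟨fun _ => hu, fun i j hij => (hij (Subsingleton.elim i j)).elim⟩
  have hb0 : b 0 = u := hb 0 rfl
  have hbi : ∀ i, i ≠ 0 → ∫ v, ⟪b i, v⟫ ^ 2 * G ⟪u, v⟫ ∂ν = ∫ v, ⟪e, v⟫ ^ 2 * G ⟪u, v⟫ ∂ν :=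
    fun i hi => h.integral_inner_sq_eq_of_norm_eq G
      (by rw [← hb0]; exact b.orthonormal.2 hi.symm) hue (by rw [b.orthonormal.1, he])
  have hsum : ∑ i, ∫ v, ⟪b i, v⟫ ^ 2 * G ⟪u, v⟫ ∂ν = ∫ v, G ⟪u, v⟫ ∂ν := by
    rw [← integral_finsetSum _ fun i _ => h.integrable (by fun_prop) hG hu]
    refine integral_congr_ae ?_
    filter_upwards [h.norm_eq_one] with v hv
    have := b.sum_sq_norm_inner_right v
    simp only [Real.norm_eq_abs, sq_abs] at this
    rw [← Finset.sum_mul, this, hv, one_pow, one_mul]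
  rw [← hsum, ← Finset.add_sum_erase _ _ (Finset.mem_univ 0), hb0,
    Finset.sum_congr rfl fun i hi => hbi i (Finset.ne_of_mem_erase hi), Finset.sum_const,
    Finset.card_erase_of_mem (Finset.mem_univ _), Finset.card_fin, nsmul_eq_mul,
    Nat.cast_pred Module.finrank_pos]

/-- Integration by parts for the rotation in the plane spanned by `u` and `w`. -/
theorem integral_inner_mul_eq [IsFiniteMeasure ν] (h : IsInvariantOnSphere ν) {g g' : ℝ → ℝ}
    (hg : ∀ t, HasDerivAt g (g' t) t) (hg' : Continuous g') {u w : E} (hu : ‖u‖ = 1)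
    (hw : ‖w‖ = 1) (huw : ⟪u, w⟫ = 0) :
    ∫ v, ⟪u, v⟫ * g ⟪u, v⟫ ∂ν = ∫ v, ⟪w, v⟫ ^ 2 * g' ⟪u, v⟫ ∂ν := by
  have hgc : Continuous g := continuous_iff_continuousAt.2 fun t => (hg t).continuousAt
  have huu : ⟪u, u⟫ = 1 := by rw [real_inner_self_eq_norm_sq, hu, one_pow]
  have hww : ⟪w, w⟫ = 1 := by rw [real_inner_self_eq_norm_sq, hw, one_pow]
  have hwu : ⟪w, u⟫ = 0 := by rw [real_inner_comm, huw]
  let F : ℝ → E → ℝ := fun θ v => (Real.sin θ * ⟪u, v⟫ - Real.cos θ * ⟪w, v⟫) *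
    g (Real.cos θ * ⟪u, v⟫ + Real.sin θ * ⟪w, v⟫)
  let F' : ℝ → E → ℝ := fun θ v => (Real.cos θ * ⟪u, v⟫ + Real.sin θ * ⟪w, v⟫) *
      g (Real.cos θ * ⟪u, v⟫ + Real.sin θ * ⟪w, v⟫) +
    (Real.sin θ * ⟪u, v⟫ - Real.cos θ * ⟪w, v⟫) *
      (g' (Real.cos θ * ⟪u, v⟫ + Real.sin θ * ⟪w, v⟫) *
        (-Real.sin θ * ⟪u, v⟫ + Real.cos θ * ⟪w, v⟫))
  have hF : ∀ θ v, HasDerivAt (fun θ => F θ v) (F' θ v) θ := by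
    intro θ v
    have h1 : HasDerivAt (fun θ => Real.cos θ * ⟪u, v⟫ + Real.sin θ * ⟪w, v⟫)
        (-Real.sin θ * ⟪u, v⟫ + Real.cos θ * ⟪w, v⟫) θ :=
      ((Real.hasDerivAt_cos θ).mul_const _).add ((Real.hasDerivAt_sin θ).mul_const _)
    have h2 : HasDerivAt (fun θ => Real.sin θ * ⟪u, v⟫ - Real.cos θ * ⟪w, v⟫)
        (Real.cos θ * ⟪u, v⟫ - -Real.sin θ * ⟪w, v⟫) θ :=
      ((Real.hasDerivAt_sin θ).mul_const _).sub ((Real.hasDerivAt_cos θ).mul_const _)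
    refine (h2.mul ((hg _).comp θ h1)).congr_deriv ?_
    simp only [F', Function.comp_apply]
    ring
  have hconst : ∀ θ, ∫ v, F θ v ∂ν = ∫ v, ⟪w, v⟫ * g ⟪u, v⟫ ∂ν := by
    intro θ
    set p : E := Real.cos (θ / 2) • u + Real.sin (θ / 2) • w with hp
    have hup : ⟪u, p⟫ = Real.cos (θ / 2) := by
      rw [hp, inner_add_right, inner_smul_right, inner_smul_right, huu, huw]; ring
    have hwp : ⟪w, p⟫ = Real.sin (θ / 2) := by
      rw [hp, inner_add_right, inner_smul_right, inner_smul_right, hww, hwu]; ring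
    have hpn : ‖p‖ ^ 2 = 1 := by
      rw [← real_inner_self_eq_norm_sq]
      nth_rewrite 1 [hp]
      rw [inner_add_left, real_inner_smul_left, real_inner_smul_left, hup, hwp, ← sq, ← sq]
      exact Real.cos_sq_add_sin_sq _
    have hr : ∀ x v : E, ⟪x, (ℝ ∙ p).reflection v⟫ =
        2 * (Real.cos (θ / 2) * ⟪u, v⟫ + Real.sin (θ / 2) * ⟪w, v⟫) * ⟪x, p⟫ - ⟪x, v⟫ := by
      intro x v
      rw [Submodule.reflection_singleton_apply, inner_sub_right, two_smul, inner_add_right,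
        inner_smul_right]
      have : ⟪p, v⟫ = Real.cos (θ / 2) * ⟪u, v⟫ + Real.sin (θ / 2) * ⟪w, v⟫ := by
        simp [hp, inner_add_left, inner_smul_left]
      rw [← this]
      simp [hpn]
      ring
    have hc : Real.cos θ = 2 * Real.cos (θ / 2) ^ 2 - 1 := by
      rw [← Real.cos_two_mul]; congr 1; ring
    have hs : Real.sin θ = 2 * Real.sin (θ / 2) * Real.cos (θ / 2) := by
      rw [← Real.sin_two_mul]; congr 1; ring
    have hsc := Real.sin_sq_add_cos_sq (θ / 2)
    rw [← h.integral_comp (ℝ ∙ p).reflection]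
    congr 1 with v
    simp only [F]
    rw [hr, hr, hup, hwp]
    congr 1
    · rw [hc, hs]; linear_combination (2 * ⟪w, v⟫) * hsc
    · congr 1
      rw [hc, hs]
      linear_combination (4 * (Real.cos (θ / 2) * Real.sin (θ / 2) * ⟪w, v⟫ +
        Real.cos (θ / 2) ^ 2 * ⟪u, v⟫)) * hsc
  obtain ⟨C, hC⟩ := (isCompact_Icc (a := (-2 : ℝ)) (b := 2)).exists_bound_of_continuousOn
    hgc.continuousOn
  obtain ⟨D, hD⟩ := (isCompact_Icc (a := (-2 : ℝ)) (b := 2)).exists_bound_of_continuousOn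
    hg'.continuousOn
  have hder := (hasDerivAt_integral_of_dominated_loc_of_deriv_le (μ := ν) (F := F) (F' := F')
    (x₀ := 0) (s := Set.univ) (bound := fun _ => 2 * C + 2 * (D * 2)) Filter.univ_mem
    (Filter.Eventually.of_forall fun θ =>
      Continuous.aestronglyMeasurable (by simp only [F]; fun_prop))
    (h.integrable_of_continuous (by simp only [F]; fun_prop))
    (Continuous.aestronglyMeasurable (by simp only [F']; fun_prop))
    (by
      filter_upwards [h.norm_eq_one] with v hv θ _
      have hb : ∀ x y a b : ℝ, |x| ≤ 1 → |y| ≤ 1 → |a| ≤ 1 → |b| ≤ 1 → |x * a + y * b| ≤ 2 := by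
        intro x y a b hx hy ha hb
        calc |x * a + y * b| ≤ |x| * |a| + |y| * |b| := by
              rw [← abs_mul, ← abs_mul]; exact abs_add_le _ _
          _ ≤ 1 * 1 + 1 * 1 := by gcongr
          _ = 2 := by norm_num
      have ha : |⟪u, v⟫| ≤ 1 := by simpa [hu, hv] using abs_real_inner_le_norm u v
      have hb' : |⟪w, v⟫| ≤ 1 := by simpa [hw, hv] using abs_real_inner_le_norm w v
      have h1 := hb _ _ _ _ (Real.abs_cos_le_one θ) (Real.abs_sin_le_one θ) ha hb'
      have h2 : |Real.sin θ * ⟪u, v⟫ - Real.cos θ * ⟪w, v⟫| ≤ 2 := by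
        rw [sub_eq_add_neg, ← neg_mul]
        exact hb _ _ _ _ (Real.abs_sin_le_one θ) (by simpa using Real.abs_cos_le_one θ) ha hb'
      have h3 := hb _ _ _ _ (by simpa using Real.abs_sin_le_one θ : |-Real.sin θ| ≤ 1)
        (Real.abs_cos_le_one θ) ha hb'
      have hC' := hC _ (abs_le.1 h1)
      have hD' := hD _ (abs_le.1 h1)
      refine (norm_add_le _ _).trans ?_
      rw [norm_mul, norm_mul, norm_mul]
      exact add_le_add (mul_le_mul h1 hC' (norm_nonneg _) zero_le_two)
        (mul_le_mul h2 (mul_le_mul hD' h3 (norm_nonneg _) ((norm_nonneg _).trans hD'))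
          (mul_nonneg (norm_nonneg _) (norm_nonneg _)) zero_le_two))
    (integrable_const _) (Filter.Eventually.of_forall fun v θ _ => hF θ v))
  obtain ⟨-, hd⟩ := hder
  have hzero : ∫ v, F' 0 v ∂ν = 0 := by
    simp only [hconst] at hd
    exact hd.unique (hasDerivAt_const _ _)
  rw [← sub_eq_zero, ← integral_sub, ← hzero]
  · congr 1 with v
    simp [F']
    ring
  · exact h.integrable_of_continuous (by fun_prop)
  · exact h.integrable_of_continuous (by fun_prop)

/-- Integration by parts for the weight `2 x 1_{x ≥ s}` and its primitive. -/
theorem integral_inner_mul_indicator_eq [IsFiniteMeasure ν] (h : IsInvariantOnSphere ν)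
    {s : ℝ} (hs0 : 0 ≤ s) (hs1 : s ≤ 1) {u w : E} (hu : ‖u‖ = 1) (hw : ‖w‖ = 1) (huw : ⟪u, w⟫ = 0) :
    ∫ v, ⟪u, v⟫ * ((⟪u, v⟫ ^ 2 - s ^ 2) * (Set.Ici s).indicator 1 ⟪u, v⟫) ∂ν =
      ∫ v, ⟪w, v⟫ ^ 2 * (2 * ⟪u, v⟫ * (Set.Ici s).indicator 1 ⟪u, v⟫) ∂ν := by
  have hle : ∀ x : E, ‖x‖ = 1 → ∀ v : E, ‖v‖ = 1 → |⟪x, v⟫| ≤ 1 := fun x hx v hv => by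
    simpa [hx, hv] using abs_real_inner_le_norm x v
  refine tendsto_nhds_unique
    (f := fun k : ℕ => ∫ v, ⟪u, v⟫ * (∫ x in s..⟪u, v⟫, capWeight s k x) ∂ν)
    (l := Filter.atTop) ?_ ?_
  · refine tendsto_integral_of_dominated_convergence (fun _ => 4) (fun k => ?_)
      (integrable_const _) (fun k => ?_) ?_
    · have hc : Continuous fun t => ∫ x in s..t, capWeight s k x :=
        continuous_iff_continuousAt.2 fun t => (hasDerivAt_integral_capWeight s k t).continuousAt
      exact Continuous.aestronglyMeasurable (by fun_prop)
    · filter_upwards [h.norm_eq_one] with v hv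
      rw [norm_mul]
      have h1 := hle u hu v hv
      have h2 := abs_integral_capWeight_le hs0 hs1 k h1
      calc _ ≤ (1 : ℝ) * 4 := mul_le_mul h1 h2 (abs_nonneg _) zero_le_one
        _ = 4 := one_mul _
    · filter_upwards [h.norm_eq_one] with v hv
      exact (tendsto_integral_capWeight hs0 hs1 (hle u hu v hv)).const_mul _
  · have heq : ∀ k : ℕ, ∫ v, ⟪u, v⟫ * (∫ x in s..⟪u, v⟫, capWeight s k x) ∂ν =
        ∫ v, ⟪w, v⟫ ^ 2 * capWeight s k ⟪u, v⟫ ∂ν := fun k =>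
      h.integral_inner_mul_eq (hasDerivAt_integral_capWeight s k) (continuous_capWeight s k)
        hu hw huw
    simp_rw [heq]
    refine tendsto_integral_of_dominated_convergence (fun _ => 2) (fun k => ?_)
      (integrable_const _) (fun k => ?_) (Filter.Eventually.of_forall fun v => ?_)
    · have := continuous_capWeight s k
      exact Continuous.aestronglyMeasurable (by fun_prop)
    · filter_upwards [h.norm_eq_one] with v hv
      rw [norm_mul, norm_pow]
      calc _ ≤ (1 : ℝ) * 2 := mul_le_mul (pow_le_one₀ (norm_nonneg _) (hle w hw v hv))
            (abs_capWeight_le hs0 hs1 k (hle u hu v hv)) (abs_nonneg _) zero_le_one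
        _ = 2 := one_mul _
    · exact (tendsto_capWeight s _).const_mul _

/-- For the height `s` with `(n + 2) s² = 1`, products of three orthogonal coordinates have mean
zero on every cap. -/
theorem integral_cap_eq_zero [IsFiniteMeasure ν] (h : IsInvariantOnSphere ν) {s : ℝ} (hs0 : 0 ≤ s)
    (hs : (Module.finrank ℝ E + 2) * s ^ 2 = 1) {u e a b c : E} (hu : ‖u‖ = 1) (he : ‖e‖ = 1)
    (hue : ⟪u, e⟫ = 0) (hab : ⟪a, b⟫ = 0) (hac : ⟪a, c⟫ = 0) (hbc : ⟪b, c⟫ = 0) :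
    ∫ v, ⟪a, v⟫ * ⟪b, v⟫ * ⟪c, v⟫ * (Set.Ici s).indicator 1 ⟪u, v⟫ ∂ν = 0 := by
  have hn : (0 : ℝ) ≤ Module.finrank ℝ E := Nat.cast_nonneg _
  have hs1 : s ≤ 1 := by nlinarith
  have hW := IsZonalWeight.indicator_Ici s
  have htrace := h.integral_inner_sq_add
    (IsZonalWeight.of_continuous_mul continuous_id hW) hu he hue
  have hparts := h.integral_inner_mul_indicator_eq hs0 hs1 hu he hue
  rw [h.integral_inner_mul_inner_mul_inner hW hu he hue hab hac hbc]
  set W : ℝ → ℝ := (Set.Ici s).indicator 1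
  have hA : ∫ v, ⟪u, v⟫ ^ 2 * (⟪u, v⟫ * W ⟪u, v⟫) ∂ν = ∫ v, ⟪u, v⟫ ^ 3 * W ⟪u, v⟫ ∂ν := by
    congr 1 with v
    ring
  have hl : ∫ v, ⟪u, v⟫ * ((⟪u, v⟫ ^ 2 - s ^ 2) * W ⟪u, v⟫) ∂ν =
      ∫ v, ⟪u, v⟫ ^ 3 * W ⟪u, v⟫ ∂ν - s ^ 2 * ∫ v, ⟪u, v⟫ * W ⟪u, v⟫ ∂ν := by
    rw [← integral_const_mul, ← integral_sub (h.integrable (by fun_prop) hW hu)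
      ((h.integrable (by fun_prop) hW hu).const_mul _)]
    congr 1 with v
    ring
  have hr : ∫ v, ⟪e, v⟫ ^ 2 * (2 * ⟪u, v⟫ * W ⟪u, v⟫) ∂ν =
      2 * ∫ v, ⟪e, v⟫ ^ 2 * (⟪u, v⟫ * W ⟪u, v⟫) ∂ν := by
    rw [← integral_const_mul]
    congr 1 with v
    ring
  rw [hl, hr] at hparts
  simp only [id] at htrace
  rw [hA] at htrace
  rw [← htrace] at hparts
  have key : (Module.finrank ℝ E + 1) * (∫ v, ⟪u, v⟫ ^ 3 * W ⟪u, v⟫ ∂ν -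
      3 * ∫ v, ⟪e, v⟫ ^ 2 * (⟪u, v⟫ * W ⟪u, v⟫) ∂ν) = 0 := by
    linear_combination (Module.finrank ℝ E + 2 : ℝ) * hparts +
      (∫ v, ⟪u, v⟫ ^ 3 * W ⟪u, v⟫ ∂ν +
        (Module.finrank ℝ E - 1) * ∫ v, ⟪e, v⟫ ^ 2 * (⟪u, v⟫ * W ⟪u, v⟫) ∂ν) * hs
  rw [(mul_eq_zero.1 key).resolve_left (by positivity), mul_zero]

end IsInvariantOnSphere

end RotationInvariant

instance (n : ℕ) : IsFiniteMeasure (sphereMeasure n) :=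
  ⟨(ENNReal.inv_mul_le_one _).trans_lt ENNReal.one_lt_top⟩

theorem isInvariantOnSphere_map_sphereMeasure (n : ℕ) :
    IsInvariantOnSphere ((sphereMeasure n).map Subtype.val) where
  preserving L := by
    let e : sphere (0 : EuclideanSpace ℝ (Fin n)) 1 ≃ᵢ sphere (0 : EuclideanSpace ℝ (Fin n)) 1 :=
      { toFun := fun v => ⟨L v, by simp⟩
        invFun := fun v => ⟨L.symm v, by simp⟩
        left_inv := fun v => by simp
        right_inv := fun v => by simp
        isometry_toFun := fun v w => L.isometry v w }
    have he : MeasurePreserving e (sphereMeasure n) (sphereMeasure n) :=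
      (e.measurePreserving_hausdorffMeasure _).smul_measure _
    refine ⟨L.continuous.measurable, ?_⟩
    rw [Measure.map_map L.continuous.measurable measurable_subtype_coe]
    conv_rhs => rw [← he.map_eq, Measure.map_map measurable_subtype_coe he.measurable]
    rfl
  norm_eq_one := by
    rw [ae_map_iff measurable_subtype_coe.aemeasurable
      (measurableSet_eq_fun measurable_norm measurable_const)]
    exact Filter.Eventually.of_forall fun v => norm_eq_of_mem_sphere v

theorem exists_norm_eq_one_inner_eq_zero {E : Type*} [NormedAddCommGroup E]
    [InnerProductSpace ℝ E] [FiniteDimensional ℝ E] (h : 1 < Module.finrank ℝ E) (u : E) :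
    ∃ e : E, ‖e‖ = 1 ∧ ⟪u, e⟫ = 0 := by
  have hK : (ℝ ∙ u)ᗮ ≠ ⊥ := fun hbot => by
    have h1 := (ℝ ∙ u).finrank_add_finrank_orthogonal
    have h2 : Module.finrank ℝ (ℝ ∙ u) ≤ 1 := by
      simpa using finrank_span_le_card (R := ℝ) {u}
    rw [hbot, finrank_bot] at h1
    omega
  obtain ⟨x, hx, hx0⟩ := Submodule.exists_mem_ne_zero_of_ne_bot hK
  refine ⟨‖x‖⁻¹ • x, norm_smul_inv_norm hx0, ?_⟩
  rw [inner_smul_right, Submodule.mem_orthogonal_singleton_iff_inner_right.1 hx, mul_zero]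

theorem stmt3 (n : ℕ) (hn : 3 ≤ n) :
    ∃ s ∈ Set.Ioo (0 : ℝ) 1,
      ∃ F : sphere (0 : EuclideanSpace ℝ (Fin n)) 1 → ℝ,
        Continuous F ∧ (∀ v, F (-v) = -F v) ∧ F ≠ 0 ∧
        ∀ u : sphere (0 : EuclideanSpace ℝ (Fin n)) 1,
          ∫ v in cap n s u, F v ∂(sphereMeasure n) = 0 := by
  have hn0 : (0 : ℝ) ≤ n := n.cast_nonneg
  obtain ⟨i, j, k, hij, hik, hjk⟩ : ∃ i j k : Fin n, i ≠ j ∧ i ≠ k ∧ j ≠ k :=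
    ⟨⟨0, by omega⟩, ⟨1, by omega⟩, ⟨2, by omega⟩, by simp, by simp, by simp⟩
  let a : Fin n → EuclideanSpace ℝ (Fin n) := fun i => EuclideanSpace.single i 1
  have ha : ∀ {i j}, i ≠ j → ⟪a i, a j⟫ = 0 := fun hij => by
    simp [a, EuclideanSpace.inner_single_left, hij]
  have hai : ∀ i v, ⟪a i, v⟫ = v i := fun i v => by simp [a, EuclideanSpace.inner_single_left]
  have hs2 : ((n : ℝ) + 2) * (√((n : ℝ) + 2))⁻¹ ^ 2 = 1 := by
    rw [inv_pow, Real.sq_sqrt (by positivity)]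
    exact mul_inv_cancel₀ (by positivity)
  refine ⟨(√((n : ℝ) + 2))⁻¹, ⟨by positivity, inv_lt_one_of_one_lt₀ ?_⟩,
    fun v => ⟪a i, (v : EuclideanSpace ℝ (Fin n))⟫ * ⟪a j, (v : EuclideanSpace ℝ (Fin n))⟫ *
      ⟪a k, (v : EuclideanSpace ℝ (Fin n))⟫, by fun_prop, fun v => ?_, fun h0 => ?_, fun u => ?_⟩
  · rw [Real.lt_sqrt zero_le_one]
    linarith
  · simp only [coe_neg_sphere, inner_neg_right]
    ring
  · let x : EuclideanSpace ℝ (Fin n) := WithLp.toLp 2 fun _ => 1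
    have hx : x ≠ 0 := fun hx => by simpa [x] using congrArg (fun y => y.ofLp i) hx
    have hv := congrFun h0 ⟨‖x‖⁻¹ • x, by simpa using norm_smul_inv_norm (𝕜 := ℝ) hx⟩
    have hxi : ∀ l, x l = 1 := fun _ => rfl
    simp [hai, hxi, hx] at hv
  · have hu : ‖(u : EuclideanSpace ℝ (Fin n))‖ = 1 := norm_eq_of_mem_sphere u
    obtain ⟨e, he, hue⟩ := exists_norm_eq_one_inner_eq_zero
      (by rw [finrank_euclideanSpace_fin]; omega) (u : EuclideanSpace ℝ (Fin n))
    have hcap : MeasurableSet (cap n (√((n : ℝ) + 2))⁻¹ u) :=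
      measurableSet_le measurable_const (by fun_prop)
    have hzero := (isInvariantOnSphere_map_sphereMeasure n).integral_cap_eq_zero
      (s := (√((n : ℝ) + 2))⁻¹) (by positivity) (by rwa [finrank_euclideanSpace_fin]) hu he hue
      (ha hij) (ha hik) (ha hjk)
    rw [(MeasurableEmbedding.subtype_coe isClosed_sphere.measurableSet).integral_map] at hzero
    rw [← integral_indicator hcap, ← hzero]
    congr 1 with v
    by_cases hv : v ∈ cap n (√((n : ℝ) + 2))⁻¹ u
    · have : (√((n : ℝ) + 2))⁻¹ ≤ ⟪(u : EuclideanSpace ℝ (Fin n)), v⟫ := hv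
      simp [hv, this]
    · have : ¬ (√((n : ℝ) + 2))⁻¹ ≤ ⟪(u : EuclideanSpace ℝ (Fin n)), v⟫ := hv
      rw [Set.indicator_of_notMem hv, Set.indicator_of_notMem (by simpa using this), mul_zero]
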